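/- Let sigma be the deterministic memory-2 strategy given by: round-1 cooperation probability 1; round-2 responses after round-1 outcome LL, LR, RL, RR equal to 1, 0, 1, 1 respectively; and later-round responses sigma_{o_{-1},o_{-2}} given (with o_{-2} ranging over LL,LR,RL,RR) by (1,0,1,1) when o_{-1}=LL, (0,0,0,0) when o_{-1}=LR, (0,1,0,0) when o_{-1}=RL, and (1,0,1,1) when o_{-1}=RR. For g=(3,0,5,1) and w=10^{-10}: pi2_{w,g}(sigma,sigma) = 3 and pi2_{w,g}(sigma',sigma) <= 3 for every memory-2 strategy sigma' in [0,1]^21; that is, sigma is a Nash equilibrium within memory-2 strategies that attains the mutual-cooperation payoff aLL = 3 against itself. -/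

import Mathlib

open Matrix

noncomputable section

/-! ## Memory-2 setting -/

/-- Swapping an outcome to the co-player's perspective: LL ↦ LL, LR ↦ RL,
RL ↦ LR, RR ↦ RR. -/
def swap4 : Fin 4 → Fin 4 := ![0, 2, 1, 3]

/-- Distribution over the outcomes (LL, LR, RL, RR) from player 1's perspective
when player 1 cooperates with probability `c1` and player 2 with probability
`c2`, independently. -/
def outProb (c1 c2 : ℝ) : Fin 4 → ℝ :=
  ![c1 * c2, c1 * (1 - c2), (1 - c1) * c2, (1 - c1) * (1 - c2)]

/-- Round-1 cooperation probability of a memory-2 strategy. -/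
def m2r1 (σ : Fin 21 → ℝ) : ℝ := σ 0

/-- Round-2 cooperation probability of a memory-2 strategy after round-1
outcome `o`. -/
def m2r2 (σ : Fin 21 → ℝ) (o : Fin 4) : ℝ :=
  σ ⟨1 + o.val, by have := o.isLt; omega⟩

/-- Later-round cooperation probability of a memory-2 strategy after last
outcome `o₁` and second-to-last outcome `o₂`. -/
def m2c (σ : Fin 21 → ℝ) (o₁ o₂ : Fin 4) : ℝ :=
  σ ⟨5 + 4 * o₁.val + o₂.val, by have := o₁.isLt; have := o₂.isLt; omega⟩

/-- Initial distribution over states `(o₋₂, o₋₁)` (round-1 outcome, round-2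
outcome), recorded from player 1's perspective, for memory-2 strategies
`σ` (player 1) and `τ` (player 2). -/
def V0 (σ τ : Fin 21 → ℝ) : Fin 4 × Fin 4 → ℝ := fun s =>
  outProb (m2r1 σ) (m2r1 τ) s.1 * outProb (m2r2 σ s.1) (m2r2 τ (swap4 s.1)) s.2

/-- Transition matrix on the 16 states `(o₋₂, o₋₁)` of consecutive outcome
pairs for memory-2 strategies `σ` (player 1) and `τ` (player 2); each player
reads outcomes from their own perspective. -/
def T (σ τ : Fin 21 → ℝ) : Matrix (Fin 4 × Fin 4) (Fin 4 × Fin 4) ℝ :=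
  Matrix.of fun s s' =>
    if s'.1 = s.2 then
      outProb (m2c σ s.2 s.1) (m2c τ (swap4 s.2) (swap4 s.1)) s'.2
    else 0

/-- Payoff vector on states: the state `(o₋₂, o₋₁)` pays player 1's stage
payoff at the last outcome `o₋₁`. -/
def ghat (g : Fin 4 → ℝ) : Fin 4 × Fin 4 → ℝ := fun s => g s.2

/-- Player 1's expected per-round payoff `π2_{w,g}(σ,τ)` between two memory-2
strategies. -/
def payoff2 (w : ℝ) (g : Fin 4 → ℝ) (σ τ : Fin 21 → ℝ) : ℝ :=
  w * ((V0 σ τ ᵥ* (1 - (1 - w) • T σ τ)⁻¹) ⬝ᵥ ghat g)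

/-- The deterministic memory-2 strategy of Statement 18: round-1 probability 1;
round-2 responses (after LL, LR, RL, RR) = (1,0,1,1); later-round responses
σ_{o₋₁,o₋₂} (o₋₂ ranging over LL,LR,RL,RR): (1,0,1,1) if o₋₁ = LL, (0,0,0,0) if
o₋₁ = LR, (0,1,0,0) if o₋₁ = RL, (1,0,1,1) if o₋₁ = RR. -/
def sigma18 : Fin 21 → ℝ :=
  ![1,
    1, 0, 1, 1,
    1, 0, 1, 1,
    0, 0, 0, 0,
    0, 1, 0, 0,
    1, 0, 1, 1]

/-- Discrete maximum principle for a discounted substochastic matrix. -/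
lemma max_principle {ι : Type*} [Fintype ι] [Nonempty ι] (P : Matrix ι ι ℝ) (r : ℝ)
    (hr0 : 0 ≤ r) (hr1 : r < 1) (hP : ∀ i j, 0 ≤ P i j) (hs : ∀ i, ∑ j, P i j = 1)
    (d : ι → ℝ) (hd : ∀ i, d i ≤ r * (P *ᵥ d) i) (i : ι) : d i ≤ 0 := by
  obtain ⟨m, hm⟩ := Finite.exists_max d
  have h1 : (P *ᵥ d) m ≤ d m := by
    calc (P *ᵥ d) m = ∑ j, P m j * d j := rfl
      _ ≤ ∑ j, P m j * d m :=
        Finset.sum_le_sum fun j _ => mul_le_mul_of_nonneg_left (hm j) (hP m j)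
      _ = d m := by rw [← Finset.sum_mul, hs, one_mul]
  have h2 : d m ≤ r * d m := (hd m).trans (mul_le_mul_of_nonneg_left h1 hr0)
  have h3 : d m ≤ 0 := by
    by_contra h
    push Not at h
    nlinarith
  exact (hm i).trans h3

lemma disc_isUnit {ι : Type*} [Fintype ι] [DecidableEq ι] [Nonempty ι] (P : Matrix ι ι ℝ) (r : ℝ)
    (hr0 : 0 ≤ r) (hr1 : r < 1) (hP : ∀ i j, 0 ≤ P i j) (hs : ∀ i, ∑ j, P i j = 1) :
    IsUnit (1 - r • P) := by
  rw [← Matrix.mulVec_injective_iff_isUnit]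
  have key : ∀ v : ι → ℝ, (1 - r • P) *ᵥ v = 0 → ∀ i, v i ≤ 0 := by
    intro v hv
    refine max_principle P r hr0 hr1 hP hs v fun i => ?_
    have := congrFun hv i
    simp only [Matrix.sub_mulVec, Matrix.one_mulVec, Matrix.smul_mulVec, Pi.sub_apply,
      Pi.smul_apply, smul_eq_mul, Pi.zero_apply] at this
    linarith
  intro a b hab
  have h1 : (1 - r • P) *ᵥ (a - b) = 0 := by
    rw [Matrix.mulVec_sub]; exact sub_eq_zero.2 hab
  have h2 : (1 - r • P) *ᵥ (b - a) = 0 := by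
    rw [Matrix.mulVec_sub]; exact sub_eq_zero.2 hab.symm
  funext i
  have e1 := key _ h1 i
  have e2 := key _ h2 i
  simp only [Pi.sub_apply] at e1 e2
  linarith

lemma outProb_nonneg {a b : ℝ} (ha : a ∈ Set.Icc (0 : ℝ) 1) (hb : b ∈ Set.Icc (0 : ℝ) 1)
    (j : Fin 4) : 0 ≤ outProb a b j := by
  have h1 := ha.1
  have h2 := hb.1
  have h3 := sub_nonneg.2 ha.2
  have h4 := sub_nonneg.2 hb.2
  fin_cases j <;> simp [outProb] <;> positivity

lemma outProb_sum (a b : ℝ) : ∑ j, outProb a b j = 1 := by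
  simp [outProb, Fin.sum_univ_four]; ring

lemma T_mulVec (σ τ : Fin 21 → ℝ) (x : Fin 4 × Fin 4 → ℝ) (a b : Fin 4) :
    (T σ τ *ᵥ x) (a, b) =
      ∑ j, outProb (m2c σ b a) (m2c τ (swap4 b) (swap4 a)) j * x (b, j) := by
  simp only [Matrix.mulVec, dotProduct, T, Matrix.of_apply, Fintype.sum_prod_type, ite_mul,
    zero_mul]
  rw [Finset.sum_eq_single b]
  · simp
  · intro c _ hc
    simp [hc]
  · simp

lemma T_nonneg {σ τ : Fin 21 → ℝ} (hσ : ∀ i, σ i ∈ Set.Icc (0 : ℝ) 1)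
    (hτ : ∀ i, τ i ∈ Set.Icc (0 : ℝ) 1) (s s' : Fin 4 × Fin 4) : 0 ≤ T σ τ s s' := by
  simp only [T, Matrix.of_apply]
  split_ifs
  · exact outProb_nonneg (hσ _) (hτ _) _
  · exact le_rfl

lemma T_sum (σ τ : Fin 21 → ℝ) (s : Fin 4 × Fin 4) : ∑ s', T σ τ s s' = 1 := by
  have h := T_mulVec σ τ (fun _ => 1) s.1 s.2
  simp only [mul_one, outProb_sum] at h
  simpa [Matrix.mulVec, dotProduct] using h

lemma V0_nonneg {σ τ : Fin 21 → ℝ} (hσ : ∀ i, σ i ∈ Set.Icc (0 : ℝ) 1)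
    (hτ : ∀ i, τ i ∈ Set.Icc (0 : ℝ) 1) (s : Fin 4 × Fin 4) : 0 ≤ V0 σ τ s :=
  mul_nonneg (outProb_nonneg (hσ _) (hτ _) _) (outProb_nonneg (hσ _) (hτ _) _)

lemma V0_sum (σ τ : Fin 21 → ℝ) : ∑ s, V0 σ τ s = 1 := by
  simp only [V0, Fintype.sum_prod_type, ← Finset.mul_sum, outProb_sum, mul_one]

lemma sigma18_mem (i : Fin 21) : sigma18 i ∈ Set.Icc (0 : ℝ) 1 := by
  fin_cases i <;> simp [sigma18]

/-- The payoff expressed through the value function of the discounted chain. -/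
lemma payoff2_value {w : ℝ} (hw0 : 0 < w) (hw1 : w ≤ 1) (g : Fin 4 → ℝ) {σ τ : Fin 21 → ℝ}
    (hσ : ∀ i, σ i ∈ Set.Icc (0 : ℝ) 1) (hτ : ∀ i, τ i ∈ Set.Icc (0 : ℝ) 1) :
    ∃ y : Fin 4 × Fin 4 → ℝ, (∀ s, y s = w * g s.2 + (1 - w) * (T σ τ *ᵥ y) s) ∧
      payoff2 w g σ τ = ∑ s, V0 σ τ s * y s := by
  have hu := disc_isUnit (T σ τ) (1 - w) (by linarith) (by linarith) (T_nonneg hσ hτ) (T_sum σ τ)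
  have hdet := (Matrix.isUnit_iff_isUnit_det _).1 hu
  set x := (1 - (1 - w) • T σ τ)⁻¹ *ᵥ ghat g with hx
  have hx' : (1 - (1 - w) • T σ τ) *ᵥ x = ghat g := by
    rw [hx, Matrix.mulVec_mulVec, Matrix.mul_nonsing_inv _ hdet, Matrix.one_mulVec]
  refine ⟨w • x, fun s => ?_, ?_⟩
  · have := congrFun hx' s
    simp only [Matrix.sub_mulVec, Matrix.one_mulVec, Matrix.smul_mulVec, Pi.sub_apply,
      Pi.smul_apply, smul_eq_mul, ghat] at this
    simp only [Matrix.mulVec_smul, Pi.smul_apply, smul_eq_mul]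
    rw [← this]; ring
  · rw [payoff2, ← Matrix.dotProduct_mulVec, ← hx, dotProduct, Finset.mul_sum]
    refine Finset.sum_congr rfl fun s _ => ?_
    simp only [Pi.smul_apply, smul_eq_mul]; ring

/-- Relative value bound (in units of `w`, relative to 3) against `sigma18`. -/
def hval : Fin 4 → Fin 4 → ℝ :=
  ![![0, -49/10, -9/10, -2], ![0, -49/10, -9/10, -2],
    ![-19/10, -3, -9/10, -39/10], ![0, -49/10, -9/10, -2]]

lemma hval_nonpos (a b : Fin 4) : hval a b ≤ 0 := by
  fin_cases a <;> fin_cases b <;> norm_num [hval]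

/-- Bellman inequality for `hval`. -/
lemma bellman {p : ℝ} (hp : p ∈ Set.Icc (0 : ℝ) 1) (a b : Fin 4) :
    (![3, 0, 5, 1] : Fin 4 → ℝ) b - 3 + (1 - ((10 : ℝ) ^ 10)⁻¹) *
      ∑ j, outProb p (m2c sigma18 (swap4 b) (swap4 a)) j * hval b j ≤ hval a b := by
  obtain ⟨h0, h1⟩ := hp
  fin_cases a <;> fin_cases b <;>
    simp [Fin.sum_univ_four, outProb, m2c, sigma18, swap4, hval] <;> norm_num <;> linarith

/-- For `g = (3,0,5,1)` and `w = 10⁻¹⁰`, the strategy `sigma18` is a Nash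
equilibrium within memory-2 strategies attaining the mutual-cooperation payoff
`aLL = 3` against itself. -/
theorem stmt18 :
    payoff2 ((10 : ℝ) ^ 10)⁻¹ ![3, 0, 5, 1] sigma18 sigma18 = 3 ∧
    ∀ σ' : Fin 21 → ℝ, (∀ i, σ' i ∈ Set.Icc (0 : ℝ) 1) →
      payoff2 ((10 : ℝ) ^ 10)⁻¹ ![3, 0, 5, 1] σ' sigma18 ≤ 3 := by
  have hw0 : (0 : ℝ) < ((10 : ℝ) ^ 10)⁻¹ := by positivity
  have hw1 : ((10 : ℝ) ^ 10)⁻¹ ≤ 1 := by norm_num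
  constructor
  · obtain ⟨y, hy, hpay⟩ := payoff2_value hw0 hw1 ![3, 0, 5, 1] sigma18_mem sigma18_mem
    have h := hy (0, 0)
    rw [T_mulVec] at h
    rw [hpay, Fintype.sum_prod_type]
    simp [Fin.sum_univ_four, outProb, m2c, m2r1, m2r2, V0, sigma18, swap4] at h ⊢
    norm_num at h
    linarith
  · intro σ' hσ
    obtain ⟨y, hy, hpay⟩ := payoff2_value hw0 hw1 ![3, 0, 5, 1] hσ sigma18_mem
    generalize hw : ((10 : ℝ) ^ 10)⁻¹ = w at *
    have hd : ∀ s : Fin 4 × Fin 4, y s - (3 + w * hval s.1 s.2) ≤ 0 := by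
      refine max_principle (T σ' sigma18) (1 - w) (by linarith) (by linarith)
        (T_nonneg hσ sigma18_mem) (T_sum _ _) (fun s => y s - (3 + w * hval s.1 s.2)) ?_
      rintro ⟨a, b⟩
      have hb := bellman (hσ ⟨5 + 4 * b.val + a.val, by omega⟩) a b
      change _ - 3 + _ * ∑ j, outProb (m2c σ' b a) _ j * _ ≤ _ at hb
      rw [hw] at hb
      have hyab := hy (a, b)
      rw [T_mulVec] at hyab ⊢
      have hs := outProb_sum (m2c σ' b a) (m2c sigma18 (swap4 b) (swap4 a))
      simp only [mul_sub, mul_add, Finset.sum_sub_distrib, Finset.sum_add_distrib,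
        ← Finset.sum_mul, hs, mul_left_comm _ w, ← Finset.mul_sum] at hyab ⊢
      have hb' := mul_le_mul_of_nonneg_left hb hw0.le
      linarith
    rw [hpay]
    calc ∑ s, V0 σ' sigma18 s * y s ≤ ∑ s, V0 σ' sigma18 s * 3 := by
          refine Finset.sum_le_sum fun s _ =>
            mul_le_mul_of_nonneg_left ?_ (V0_nonneg hσ sigma18_mem s)
          have h1 := hd s
          have h2 := mul_nonneg hw0.le (neg_nonneg.2 (hval_nonpos s.1 s.2))
          linarith
      _ = 3 := by rw [← Finset.sum_mul, V0_sum, one_mul]
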